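/- For every 3-server instance on the circle of circumference 2Δ, the total extended cost is bounded: Σ_{t=1}^T max over configurations X of (w_t(X) − w_{t−1}(X)) ≤ 4·OPT + c, where c is a constant depending only on Δ and the initial configuration X₀ (but not on the number of requests T). -/

import Mathlib

open Finset

/-- Minimum-matching (Wasserstein) distance between two `k`-point configurations,
represented as `k`-tuples of points. -/
noncomputable def confDist {Ω : Type*} [MetricSpace Ω] {k : ℕ} (X Y : Fin k → Ω) : ℝ :=
  ⨅ σ : Equiv.Perm (Fin k), ∑ i, dist (X i) (Y (σ i))

/-- The work function at time `t` of the `k`-server instance with initial configuration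
`X₀` and requests `r 1, r 2, …` (the value `r 0` is unused): the least cost of serving
the first `t` requests and then moving to the configuration `X`. -/
noncomputable def workFn {Ω : Type*} [MetricSpace Ω] (k : ℕ) (X₀ : Fin k → Ω)
    (r : ℕ → Ω) (t : ℕ) (X : Fin k → Ω) : ℝ :=
  sInf { c : ℝ | ∃ Y : ℕ → Fin k → Ω, Y 0 = X₀ ∧
    (∀ i ∈ Finset.Icc 1 t, ∃ j, Y i j = r i) ∧
    c = (∑ i ∈ Finset.Icc 1 t, confDist (Y (i - 1)) (Y i)) + confDist (Y t) X }

/-- The offline optimum of the `k`-server instance with initial configuration `X₀`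
and requests `r 1, …, r T`. -/
noncomputable def opt {Ω : Type*} [MetricSpace Ω] (k : ℕ) (X₀ : Fin k → Ω)
    (r : ℕ → Ω) (T : ℕ) : ℝ :=
  sInf { c : ℝ | ∃ Y : ℕ → Fin k → Ω, Y 0 = X₀ ∧
    (∀ i ∈ Finset.Icc 1 T, ∃ j, Y i j = r i) ∧
    c = ∑ i ∈ Finset.Icc 1 T, confDist (Y (i - 1)) (Y i) }

/-- `OPT_t(Z)`: the least cost of serving the first `t` requests while ending
in the configuration `Z`. -/
noncomputable def optTo {Ω : Type*} [MetricSpace Ω] (k : ℕ) (X₀ : Fin k → Ω)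
    (r : ℕ → Ω) (t : ℕ) (Z : Fin k → Ω) : ℝ :=
  sInf { c : ℝ | ∃ Y : ℕ → Fin k → Ω, Y 0 = X₀ ∧
    (∀ i ∈ Finset.Icc 1 t, ∃ j, Y i j = r i) ∧ Y t = Z ∧
    c = ∑ i ∈ Finset.Icc 1 t, confDist (Y (i - 1)) (Y i) }

/-- `X 0, X 1, …, X T` is a run of the work function algorithm on the `k`-server
instance with initial configuration `X₀` and requests `r 1, …, r T`. -/
def IsWFARun {Ω : Type*} [MetricSpace Ω] (k : ℕ) (X₀ : Fin k → Ω)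
    (r : ℕ → Ω) (T : ℕ) (X : ℕ → Fin k → Ω) : Prop :=
  X 0 = X₀ ∧ ∀ t, 1 ≤ t → t ≤ T →
    (∃ j, X t j = r t) ∧
    ∀ Z : Fin k → Ω, (∃ j, Z j = r t) →
      optTo k X₀ r t (X t) + confDist (X t) (X (t - 1)) ≤
        optTo k X₀ r t Z + confDist Z (X (t - 1))

/-- Relation between the distances `x`, `y` of two points to a base point of a circle of
half-circumference `D` and their mutual distance `d`; `s` tells whether the two points lie
on the same half circle starting at the base point. -/
def PairDist (D : ℝ) (s : Bool) (x y d : ℝ) : Prop :=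
  if s then 0 ≤ d ∧ (d = x - y ∨ d = y - x) else d ≤ D ∧ (d = x + y ∨ d = 2 * D - (x + y))

/-- A metric space that looks like a circle of half-circumference `D` with antipodal map `bar`. -/
structure IsCircle {Ω : Type*} [MetricSpace Ω] (D : ℝ) (bar : Ω → Ω) : Prop where
  dist_bar : ∀ x y, dist (bar x) y = D - dist x y
  bar_bar : ∀ x, bar (bar x) = x
  side : ∀ r, ∃ σ : Ω → Bool, ∀ x y, PairDist D (σ x == σ y) (dist x r) (dist y r) (dist x y)

/-- Symmetric `1`-Lipschitz functions of two points satisfying a four-point exchange property. -/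
structure IsPairFn {Ω : Type*} [MetricSpace Ω] (f : Ω → Ω → ℝ) : Prop where
  symm : ∀ x y, f x y = f y x
  lip : ∀ x x' y, f x y ≤ f x' y + dist x x'
  exch : ∀ p q s t, f p s + f q t ≤ f p q + f s t ∨ f p t + f q s ≤ f p q + f s t

/-- The part of the potential, anchored at the request `r`, which depends on the cyclic triple
`(x, y, z)`. -/
def triVal {Ω : Type*} [MetricSpace Ω] (f : Ω → Ω → ℝ) (bar : Ω → Ω) (r x y z : Ω) : ℝ :=
  f (bar r) (bar r) + f x (bar y) + f y (bar z) + f z (bar x) - dist x y - dist y z - dist z x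

section CircleGeometry

variable {Ω : Type*} [MetricSpace Ω] {D : ℝ} {bar : Ω → Ω}

lemma IsCircle.bar_dist (hc : IsCircle D bar) (x y : Ω) : dist x (bar y) = D - dist x y := by
  rw [dist_comm, hc.dist_bar, dist_comm]

lemma IsCircle.dist_le (hc : IsCircle D bar) (x y : Ω) : dist x y ≤ D := by
  have h := hc.dist_bar x y
  have h' : 0 ≤ dist (bar x) y := dist_nonneg
  linarith

lemma IsCircle.perimeter_le (hc : IsCircle D bar) (x y z : Ω) :
    dist x y + dist y z + dist x z ≤ 2 * D := by
  have h := dist_triangle x (bar y) z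
  rw [hc.bar_dist, hc.dist_bar] at h
  linarith

lemma IsPairFn.lip_both {f : Ω → Ω → ℝ} (hf : IsPairFn f) (x x' y y' : Ω) :
    f x y ≤ f x' y' + dist x x' + dist y y' := by
  have h := hf.lip x x' y
  have h' := hf.lip y y' x'
  rw [hf.symm y, hf.symm y'] at h'
  linarith

lemma IsPairFn.diag_exch {f : Ω → Ω → ℝ} (hf : IsPairFn f) (x s t : Ω) :
    f x s + f x t ≤ f x x + f s t := by
  rcases hf.exch x x s t with h | h <;> linarith

lemma pairDist_cover_ATS {D a u v au av uv p : ℝ} {su sv : Bool}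
    (hau : PairDist D su a u au) (hav : PairDist D sv a v av) (huv : PairDist D (su == sv) u v uv)
    (hp : p ≤ 2 * D) :
    p ≤ u + v + uv ∨ p ≤ 2 * D - au - av + uv ∨ av + v ≤ a + (2 * D - p) ∨
      au + u ≤ a + (2 * D - p) ∨
      uv + v ≤ u + (2 * D - p) ∨ au + uv ≤ av + (2 * D - p) ∨ p ≤ a + v + av := by
  by_contra! h
  obtain ⟨h1, h2, h3, h4, h5, h6, h7⟩ := h
  unfold PairDist at *
  cases su <;> cases sv <;> simp at hau hav huv <;>
    obtain ⟨hau0, rfl | rfl⟩ := hau <;> obtain ⟨hav0, rfl | rfl⟩ := hav <;>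
      obtain ⟨huv0, rfl | rfl⟩ := huv <;>
    linarith

lemma pairDist_cover_SSS {D u v w uv uw vw : ℝ} {sv sw : Bool}
    (hu : 0 ≤ u) (hv : 0 ≤ v) (hw : 0 ≤ w)
    (huv : PairDist D sv u v uv) (huw : PairDist D sw u w uw) (hvw : PairDist D (sv == sw) v w vw) :
    uv + vw ≤ u + w ∨ uw + vw ≤ u + v ∨ uv + uw ≤ v + w := by
  by_contra! h
  obtain ⟨h1, h2, h3⟩ := h
  unfold PairDist at *
  cases sv <;> cases sw <;> simp at huv huw hvw <;>
    obtain ⟨huv0, rfl | rfl⟩ := huv <;> obtain ⟨huw0, rfl | rfl⟩ := huw <;>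
      obtain ⟨hvw0, rfl | rfl⟩ := hvw <;>
    linarith

set_option maxHeartbeats 8000000 in
lemma pairDist_cover_ASS {D a u v w au av aw uv uw vw p : ℝ} {su sv sw : Bool}
    (ha : 0 ≤ a) (hu : 0 ≤ u) (hv : 0 ≤ v) (hw : 0 ≤ w)
    (hau : PairDist D su a u au) (hav : PairDist D sv a v av) (haw : PairDist D sw a w aw)
    (huv : PairDist D (su == sv) u v uv) (huw : PairDist D (su == sw) u w uw)
    (hvw : PairDist D (sv == sw) v w vw)
    (hp : p = uv + vw + uw) (hp' : p ≤ 2 * D) :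
    p ≤ a + v + av ∨ p ≤ uw + u + w ∨ p ≤ aw + a + w ∨ p ≤ uv + u + v ∨
      2 * D + p ≤ vw + v + w + (2 * D - au - av + uv) ∨ 2 * D + p ≤ vw + v + w + (au + av + uv) ∨
      2 * D + p ≤ vw + v + w + (2 * D - au - aw + uw) ∨
      2 * D + p ≤ vw + v + w + (au + aw + uw) := by
  by_contra! h
  obtain ⟨h1, h2, h3, h4, h5, h6, h7, h8⟩ := h
  unfold PairDist at *
  cases su <;> cases sv <;> cases sw <;> simp at hau hav haw huv huw hvw <;>
    obtain ⟨hau0, rfl | rfl⟩ := hau <;> obtain ⟨hav0, rfl | rfl⟩ := hav <;>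
    obtain ⟨haw0, rfl | rfl⟩ := haw <;>
      obtain ⟨huv0, rfl | rfl⟩ := huv <;> obtain ⟨huw0, rfl | rfl⟩ := huw <;>
      obtain ⟨hvw0, rfl | rfl⟩ := hvw <;>
    linarith

set_option maxHeartbeats 16000000 in
lemma pairDist_cover_AAS {D a u v w au av aw uv uw vw p : ℝ} {su sv sw : Bool}
    (ha : 0 ≤ a) (hu : 0 ≤ u) (hv : 0 ≤ v) (hw : 0 ≤ w)
    (hau : PairDist D su a u au) (hav : PairDist D sv a v av) (haw : PairDist D sw a w aw)
    (huv : PairDist D (su == sv) u v uv) (huw : PairDist D (su == sw) u w uw)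
    (hvw : PairDist D (sv == sw) v w vw)
    (hp : p = uv + vw + uw) (hp' : p ≤ 2 * D) :
    p ≤ a + v + av ∨ p ≤ uv + av + au ∨ 2 * D + p ≤ vw + v + w + (2 * D - au - av + uv) ∨
      2 * D + p ≤ uw + u + w + (2 * D - au - av + uv) ∨ p + av + uv ≤ uw + u + w + au ∨
      (v + av ≤ 2 * D - p + a ∧ p ≤ aw + a + w) ∨ (v + av ≤ 2 * D - p + a ∧ p ≤ au + a + u) ∨
      (av + uv ≤ 2 * D - p + au ∧ p ≤ au + a + u) ∨
      p + au + uv ≤ vw + v + w + av ∨ p + au + uv ≤ uw + u + w + av := by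
  by_contra! h
  obtain ⟨h1, h2, h3, h4, h5, h6, h7, h8, h9, h10⟩ := h
  unfold PairDist at *
  rcases le_or_gt (v + av) (2 * D - p + a) with hb | hb <;>
    [(specialize h6 hb; specialize h7 hb; clear h8);
    (clear h6 h7; rcases le_or_gt (av + uv) (2 * D - p + au) with hc | hc <;>
      [specialize h8 hc; clear h8])] <;>
  cases su <;> cases sv <;> cases sw <;> simp at hau hav haw huv huw hvw <;>
    obtain ⟨hau0, rfl | rfl⟩ := hau <;> obtain ⟨hav0, rfl | rfl⟩ := hav <;>
    obtain ⟨haw0, rfl | rfl⟩ := haw <;>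
      obtain ⟨huv0, rfl | rfl⟩ := huv <;> obtain ⟨huw0, rfl | rfl⟩ := huw <;>
      obtain ⟨hvw0, rfl | rfl⟩ := hvw <;>
    linarith

lemma IsCircle.geometry_SSS (hc : IsCircle D bar) (r u v w : Ω) :
    dist u v + dist v w ≤ dist u r + dist w r ∨ dist u w + dist v w ≤ dist u r + dist v r ∨
      dist u v + dist u w ≤ dist v r + dist w r := by
  obtain ⟨σ, h⟩ := hc.side r
  have key : ∀ x y, ((σ u == σ x) == (σ u == σ y)) = (σ x == σ y) := fun x y => by
    cases σ u <;> cases σ x <;> cases σ y <;> rfl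
  exact pairDist_cover_SSS dist_nonneg dist_nonneg dist_nonneg (h u v) (h u w) (key v w ▸ h v w)

lemma IsCircle.geometry_ATS (hc : IsCircle D bar) (r a u v w : Ω) :
    dist u v + dist v w + dist u w ≤ dist u r + dist v r + dist u v ∨
      dist u v + dist v w + dist u w ≤ 2 * D - dist a u - dist a v + dist u v ∨
      dist a v + dist v r ≤ dist a r + (2 * D - (dist u v + dist v w + dist u w)) ∨
      dist a u + dist u r ≤ dist a r + (2 * D - (dist u v + dist v w + dist u w)) ∨
      dist u v + dist v r ≤ dist u r + (2 * D - (dist u v + dist v w + dist u w)) ∨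
      dist a u + dist u v ≤ dist a v + (2 * D - (dist u v + dist v w + dist u w)) ∨
      dist u v + dist v w + dist u w ≤ dist a r + dist v r + dist a v := by
  obtain ⟨σ, h⟩ := hc.side r
  have key : ∀ x y, ((σ a == σ x) == (σ a == σ y)) = (σ x == σ y) := fun x y => by
    cases σ a <;> cases σ x <;> cases σ y <;> rfl
  exact pairDist_cover_ATS (h a u) (h a v) (key u v ▸ h u v) (hc.perimeter_le u v w)

lemma IsCircle.geometry_ASS (hc : IsCircle D bar) (r a u v w : Ω) :
    dist u v + dist v w + dist u w ≤ dist a r + dist v r + dist a v ∨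
      dist u v + dist v w + dist u w ≤ dist u w + dist u r + dist w r ∨
      dist u v + dist v w + dist u w ≤ dist a w + dist a r + dist w r ∨
      dist u v + dist v w + dist u w ≤ dist u v + dist u r + dist v r ∨
      2 * D + (dist u v + dist v w + dist u w) ≤
        dist v w + dist v r + dist w r + (2 * D - dist a u - dist a v + dist u v) ∨
      2 * D + (dist u v + dist v w + dist u w) ≤
        dist v w + dist v r + dist w r + (dist a u + dist a v + dist u v) ∨
      2 * D + (dist u v + dist v w + dist u w) ≤
        dist v w + dist v r + dist w r + (2 * D - dist a u - dist a w + dist u w) ∨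
      2 * D + (dist u v + dist v w + dist u w) ≤
        dist v w + dist v r + dist w r + (dist a u + dist a w + dist u w) := by
  obtain ⟨σ, h⟩ := hc.side r
  have key : ∀ x y, ((σ a == σ x) == (σ a == σ y)) = (σ x == σ y) := fun x y => by
    cases σ a <;> cases σ x <;> cases σ y <;> rfl
  exact pairDist_cover_ASS dist_nonneg dist_nonneg dist_nonneg dist_nonneg (h a u) (h a v) (h a w)
    (key u v ▸ h u v) (key u w ▸ h u w) (key v w ▸ h v w) rfl (hc.perimeter_le u v w)

lemma IsCircle.geometry_AAS (hc : IsCircle D bar) (r a u v w : Ω) :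
    dist u v + dist v w + dist u w ≤ dist a r + dist v r + dist a v ∨
      dist u v + dist v w + dist u w ≤ dist u v + dist a v + dist a u ∨
      2 * D + (dist u v + dist v w + dist u w) ≤
        dist v w + dist v r + dist w r + (2 * D - dist a u - dist a v + dist u v) ∨
      2 * D + (dist u v + dist v w + dist u w) ≤
        dist u w + dist u r + dist w r + (2 * D - dist a u - dist a v + dist u v) ∨
      dist u v + dist v w + dist u w + dist a v + dist u v ≤
        dist u w + dist u r + dist w r + dist a u ∨
      (dist v r + dist a v ≤ 2 * D - (dist u v + dist v w + dist u w) + dist a r ∧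
        dist u v + dist v w + dist u w ≤ dist a w + dist a r + dist w r) ∨
      (dist v r + dist a v ≤ 2 * D - (dist u v + dist v w + dist u w) + dist a r ∧
        dist u v + dist v w + dist u w ≤ dist a u + dist a r + dist u r) ∨
      (dist a v + dist u v ≤ 2 * D - (dist u v + dist v w + dist u w) + dist a u ∧
        dist u v + dist v w + dist u w ≤ dist a u + dist a r + dist u r) ∨
      dist u v + dist v w + dist u w + dist a u + dist u v ≤
        dist v w + dist v r + dist w r + dist a v ∨
      dist u v + dist v w + dist u w + dist a u + dist u v ≤
        dist u w + dist u r + dist w r + dist a v := by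
  obtain ⟨σ, h⟩ := hc.side r
  have key : ∀ x y, ((σ a == σ x) == (σ a == σ y)) = (σ x == σ y) := fun x y => by
    cases σ a <;> cases σ x <;> cases σ y <;> rfl
  exact pairDist_cover_AAS dist_nonneg dist_nonneg dist_nonneg dist_nonneg
    (h a u) (h a v) (h a w) (key u v ▸ h u v) (key u w ▸ h u w)
    (key v w ▸ h v w) rfl (hc.perimeter_le u v w)

variable {f : Ω → Ω → ℝ}

lemma exists_triVal_le_AAA (hc : IsCircle D bar) (hf : IsPairFn f) (r a u v w : Ω) :
    ∃ x y z, triVal f bar r x y z ≤ f (bar a) (bar a) - dist a r + (f u (bar v) + dist a r)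
      + (f v (bar w) + dist a r) + (f w (bar u) + dist a r)
      - (dist u v + dist v w + dist w u) := by
  refine ⟨u, v, w, ?_⟩
  have h := hf.lip_both (bar r) (bar a) (bar r) (bar a)
  simp only [triVal, hc.dist_bar, hc.bar_dist, dist_comm] at h ⊢
  linarith

lemma exists_triVal_le_AST (hc : IsCircle D bar) (hf : IsPairFn f) (r a u v w : Ω) :
    ∃ x y z, triVal f bar r x y z ≤ f (bar a) (bar a) - dist a r + (f u (bar v) + dist a r)
      + (f a (bar w) + dist v r) + (f w a + dist (bar u) r)
      - (dist u v + dist v w + dist w u) := by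
  refine ⟨bar a, a, bar w, ?_⟩
  have h := hf.lip_both (bar r) u (bar r) (bar v)
  have hp := hc.perimeter_le u v w
  simp only [triVal, hc.dist_bar, hc.bar_dist, hc.bar_bar, dist_comm, dist_self, hf.symm] at h hp ⊢
  linarith

lemma exists_triVal_le_SST (hc : IsCircle D bar) (hf : IsPairFn f) (r a u v w : Ω) :
    ∃ x y z, triVal f bar r x y z ≤ f (bar a) (bar a) - dist a r + (f a (bar v) + dist u r)
      + (f a (bar w) + dist v r) + (f w a + dist (bar u) r)
      - (dist u v + dist v w + dist w u) := by
  refine ⟨bar a, a, bar w, ?_⟩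
  have h := hf.lip_both (bar r) a (bar r) (bar v)
  have hp := hc.perimeter_le u v w
  simp only [triVal, hc.dist_bar, hc.bar_dist, hc.bar_bar, dist_comm, dist_self, hf.symm] at h hp ⊢
  linarith

lemma triVal_le_SSS (hc : IsCircle D bar) (hf : IsPairFn f) (r a u v w : Ω)
    (hg : dist u v + dist v w ≤ dist u r + dist w r) :
    triVal f bar r (bar a) a (bar u) ≤ f (bar a) (bar a) - dist a r + (f a (bar v) + dist u r)
      + (f a (bar w) + dist v r) + (f a (bar u) + dist w r)
      - (dist u v + dist v w + dist w u) := by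
  have h := hf.lip_both (bar r) a (bar r) (bar v)
  have h' := hf.lip_both a a u (bar w)
  simp only [triVal, hc.dist_bar, hc.bar_dist, hc.bar_bar, dist_comm, dist_self, hf.symm]
    at h h' hg ⊢
  linarith

lemma exists_triVal_le_SSS (hc : IsCircle D bar) (hf : IsPairFn f) (r a u v w : Ω) :
    ∃ x y z, triVal f bar r x y z ≤ f (bar a) (bar a) - dist a r + (f a (bar v) + dist u r)
      + (f a (bar w) + dist v r) + (f a (bar u) + dist w r)
      - (dist u v + dist v w + dist w u) := by
  rcases hc.geometry_SSS r u v w with h | h | h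
  · exact ⟨_, _, _, triVal_le_SSS hc hf r a u v w h⟩
  · exact ⟨_, _, _, (triVal_le_SSS hc hf r a v w u
      (by simp only [dist_comm] at h ⊢; linarith)).trans (by linarith)⟩
  · exact ⟨_, _, _, (triVal_le_SSS hc hf r a w u v
      (by simp only [dist_comm] at h ⊢; linarith)).trans (by linarith)⟩

lemma exists_triVal_le_ATS (hc : IsCircle D bar) (hf : IsPairFn f) (r a u v w : Ω) :
    ∃ x y z, triVal f bar r x y z ≤ f (bar a) (bar a) - dist a r + (f u (bar v) + dist a r)
      + (f v a + dist (bar w) r) + (f a (bar u) + dist w r)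
      - (dist u v + dist v w + dist w u) := by
  rcases hc.geometry_ATS r a u v w with hg | hg | hg | hg | hg | hg | hg
  · refine ⟨bar a, a, bar u, ?_⟩
    rcases hf.exch u (bar v) v a with h | h
    · have h1 := hf.lip_both (bar r) u (bar r) v
      have h2 := hf.lip_both u (bar v) a a
      simp only [triVal, hc.dist_bar, hc.bar_dist, hc.bar_bar, dist_comm, dist_self, hf.symm]
        at h h1 h2 hg ⊢
      linarith
    · have h1 := hf.lip_both (bar r) v (bar r) (bar v)
      simp only [triVal, hc.dist_bar, hc.bar_dist, hc.bar_bar, dist_comm, dist_self, hf.symm]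
        at h h1 hg ⊢
      linarith [hc.perimeter_le u v w]
  · refine ⟨bar a, u, v, ?_⟩
    have h := hf.diag_exch (bar a) a (bar u)
    have h1 := hf.lip_both (bar r) a (bar r) (bar a)
    simp only [triVal, hc.dist_bar, hc.bar_dist, hc.bar_bar, dist_comm, hf.symm]
      at h h1 hg ⊢
    linarith
  · refine ⟨bar a, a, bar u, ?_⟩
    rcases hf.exch u (bar v) v a with h | h
    · have h1 := hf.lip_both a v u u
      have h2 := hf.lip_both (bar r) a (bar r) (bar v)
      simp only [triVal, hc.dist_bar, hc.bar_dist, hc.bar_bar, dist_comm, dist_self, hf.symm]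
        at h h1 h2 hg ⊢
      linarith
    · have h1 := hf.lip_both (bar r) v (bar r) (bar v)
      simp only [triVal, hc.dist_bar, hc.bar_dist, hc.bar_bar, dist_comm, dist_self, hf.symm]
        at h h1 hg ⊢
      linarith [hc.perimeter_le u v w]
  · refine ⟨bar a, a, bar v, ?_⟩
    have h1 := hf.lip_both a u (bar v) (bar v)
    have h2 := hf.lip_both (bar r) a (bar r) (bar u)
    simp only [triVal, hc.dist_bar, hc.bar_dist, hc.bar_bar, dist_comm, dist_self, hf.symm]
      at h1 h2 hg ⊢
    linarith
  · refine ⟨bar a, a, bar u, ?_⟩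
    have h1 := hf.lip_both u v a a
    have h2 := hf.lip_both (bar r) u (bar r) (bar v)
    simp only [triVal, hc.dist_bar, hc.bar_dist, hc.bar_bar, dist_comm, dist_self, hf.symm]
      at h1 h2 hg ⊢
    linarith
  · rcases hf.exch u (bar v) v a with h | h
    · refine ⟨bar a, u, bar v, ?_⟩
      have h1 := hf.diag_exch (bar a) a (bar u)
      have h2 := hf.lip_both (bar r) a (bar r) (bar a)
      simp only [triVal, hc.dist_bar, hc.bar_dist, hc.bar_bar, dist_comm, hf.symm]
        at h h1 h2 hg ⊢
      linarith
    · refine ⟨bar a, a, bar u, ?_⟩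
      have h1 := hf.lip_both (bar r) v (bar r) (bar v)
      simp only [triVal, hc.dist_bar, hc.bar_dist, hc.bar_bar, dist_comm, dist_self, hf.symm]
        at h h1 hg ⊢
      linarith [hc.perimeter_le u v w]
  · refine ⟨bar a, a, bar u, ?_⟩
    have h1 := hf.lip_both u u a (bar v)
    have h2 := hf.lip_both (bar r) a (bar r) v
    simp only [triVal, hc.dist_bar, hc.bar_dist, hc.bar_bar, dist_comm, dist_self, hf.symm]
      at h1 h2 hg ⊢
    linarith

lemma exists_triVal_le_ASS (hc : IsCircle D bar) (hf : IsPairFn f) (r a u v w : Ω) :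
    ∃ x y z, triVal f bar r x y z ≤ f (bar a) (bar a) - dist a r + (f u (bar v) + dist a r)
      + (f a (bar w) + dist v r) + (f a (bar u) + dist w r)
      - (dist u v + dist v w + dist w u) := by
  rcases hc.geometry_ASS r a u v w with hg | hg | hg | hg | hg | hg | hg | hg
  · refine ⟨bar a, a, bar u, ?_⟩
    have h1 := hf.lip_both u u a (bar v)
    have h2 := hf.lip_both (bar r) a (bar r) (bar w)
    simp only [triVal, hc.dist_bar, hc.bar_dist, hc.bar_bar, dist_comm, dist_self, hf.symm]
      at h1 h2 hg ⊢
    linarith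
  · refine ⟨bar a, a, bar u, ?_⟩
    have h1 := hf.lip_both u (bar w) a a
    have h2 := hf.lip_both (bar r) u (bar r) (bar v)
    simp only [triVal, hc.dist_bar, hc.bar_dist, hc.bar_bar, dist_comm, dist_self, hf.symm]
      at h1 h2 hg ⊢
    linarith
  · rcases hf.exch u (bar v) a (bar w) with h0 | h0
    · refine ⟨bar a, a, bar u, ?_⟩
      have h2 := hf.lip_both (bar r) (bar v) (bar r) (bar w)
      simp only [triVal, hc.dist_bar, hc.bar_dist, hc.bar_bar, dist_comm, dist_self, hf.symm]
        at h0 h2 hg ⊢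
      linarith [hc.perimeter_le u v w, hc.perimeter_le r v w, hc.perimeter_le r u w]
    · refine ⟨bar a, a, bar u, ?_⟩
      have h2 := hf.lip_both u u a (bar w)
      have h3 := hf.lip_both (bar r) a (bar r) (bar v)
      simp only [triVal, hc.dist_bar, hc.bar_dist, hc.bar_bar, dist_comm, dist_self, hf.symm]
        at h0 h2 h3 hg ⊢
      linarith
  · rcases hf.exch u (bar v) a (bar w) with h0 | h0
    · refine ⟨bar a, a, bar u, ?_⟩
      have h2 := hf.lip_both (bar r) (bar v) (bar r) (bar w)
      simp only [triVal, hc.dist_bar, hc.bar_dist, hc.bar_bar, dist_comm, dist_self, hf.symm]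
        at h0 h2 hg ⊢
      linarith [hc.perimeter_le u v w, hc.perimeter_le r v w, hc.perimeter_le r u w]
    · refine ⟨bar a, a, bar u, ?_⟩
      have h2 := hf.lip_both u (bar v) a a
      have h3 := hf.lip_both (bar r) u (bar r) (bar w)
      simp only [triVal, hc.dist_bar, hc.bar_dist, hc.bar_bar, dist_comm, dist_self, hf.symm]
        at h0 h2 h3 hg ⊢
      linarith
  · refine ⟨bar a, u, v, ?_⟩
    have h1 := hf.diag_exch (bar a) a (bar u)
    have h2 := hf.lip_both v (bar w) a a
    have h3 := hf.lip_both (bar r) (bar a) (bar r) a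
    simp only [triVal, hc.dist_bar, hc.bar_dist, hc.bar_bar, dist_comm, dist_self, hf.symm]
      at h1 h2 h3 hg ⊢
    linarith
  · refine ⟨a, u, v, ?_⟩
    have h1 := hf.diag_exch (bar a) a (bar w)
    have h2 := hf.lip_both v (bar w) (bar a) (bar a)
    have h3 := hf.lip_both (bar r) (bar a) (bar r) a
    simp only [triVal, hc.dist_bar, hc.bar_dist, dist_comm, dist_self, hf.symm]
      at h1 h2 h3 hg ⊢
    linarith
  · rcases hf.exch u (bar v) a (bar w) with h0 | h0
    · refine ⟨bar a, a, bar u, ?_⟩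
      have h2 := hf.lip_both (bar r) (bar v) (bar r) (bar w)
      simp only [triVal, hc.dist_bar, hc.bar_dist, hc.bar_bar, dist_comm, dist_self, hf.symm]
        at h0 h2 hg ⊢
      linarith [hc.perimeter_le u v w, hc.perimeter_le r v w, hc.perimeter_le r u w]
    · refine ⟨bar a, u, w, ?_⟩
      have h2 := hf.diag_exch (bar a) a (bar u)
      have h3 := hf.lip_both w (bar v) a a
      have h4 := hf.lip_both (bar r) (bar a) (bar r) a
      simp only [triVal, hc.dist_bar, hc.bar_dist, hc.bar_bar, dist_comm, dist_self, hf.symm]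
        at h0 h2 h3 h4 hg ⊢
      linarith
  · rcases hf.exch u (bar v) a (bar w) with h0 | h0
    · refine ⟨bar a, a, bar u, ?_⟩
      have h2 := hf.lip_both (bar r) (bar v) (bar r) (bar w)
      simp only [triVal, hc.dist_bar, hc.bar_dist, hc.bar_bar, dist_comm, dist_self, hf.symm]
        at h0 h2 hg ⊢
      linarith [hc.perimeter_le u v w, hc.perimeter_le r v w, hc.perimeter_le r u w]
    · refine ⟨a, u, w, ?_⟩
      have h2 := hf.diag_exch (bar a) a (bar v)
      have h3 := hf.lip_both w (bar v) (bar a) (bar a)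
      have h4 := hf.lip_both (bar r) (bar a) (bar r) a
      simp only [triVal, hc.dist_bar, hc.bar_dist, dist_comm, dist_self, hf.symm]
        at h0 h2 h3 h4 hg ⊢
      linarith

lemma exists_triVal_le_AAS (hc : IsCircle D bar) (hf : IsPairFn f) (r a u v w : Ω) :
    ∃ x y z, triVal f bar r x y z ≤ f (bar a) (bar a) - dist a r + (f u (bar v) + dist a r)
      + (f v (bar w) + dist a r) + (f a (bar u) + dist w r)
      - (dist u v + dist v w + dist w u) := by
  rcases hc.geometry_AAS r a u v w with hg | hg | hg | hg | hg | hg | hg | hg | hg | hg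
  · refine ⟨bar a, a, bar u, ?_⟩
    have h1 := hf.lip_both u u a (bar v)
    have h2 := hf.lip_both (bar r) v (bar r) (bar w)
    simp only [triVal, hc.dist_bar, hc.bar_dist, hc.bar_bar, dist_comm, dist_self, hf.symm]
      at h1 h2 hg ⊢
    linarith
  · refine ⟨u, v, a, ?_⟩
    have h1 := hf.diag_exch (bar a) v (bar w)
    have h2 := hf.lip_both (bar r) (bar a) (bar r) (bar w)
    simp only [triVal, hc.dist_bar, hc.bar_dist, dist_comm, hf.symm]
      at h1 h2 hg ⊢
    linarith
  · rcases hf.exch v (bar w) a (bar u) with h0 | h0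
    · refine ⟨bar a, u, v, ?_⟩
      have h2 := hf.diag_exch (bar a) (bar w) (bar u)
      have h3 := hf.lip_both (bar r) (bar a) (bar r) (bar w)
      simp only [triVal, hc.dist_bar, hc.bar_dist, hc.bar_bar, dist_comm, hf.symm]
        at h0 h2 h3 hg ⊢
      linarith [hc.perimeter_le u v w, hc.perimeter_le r v w, hc.perimeter_le r u w]
    · refine ⟨bar a, u, v, ?_⟩
      have h2 := hf.diag_exch (bar a) v (bar u)
      have h3 := hf.lip_both v (bar w) a a
      have h4 := hf.lip_both (bar r) (bar a) (bar r) v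
      simp only [triVal, hc.dist_bar, hc.bar_dist, hc.bar_bar, dist_comm, dist_self, hf.symm]
        at h0 h2 h3 h4 hg ⊢
      linarith
  · rcases hf.exch v (bar w) a (bar u) with h0 | h0
    · refine ⟨bar a, u, v, ?_⟩
      have h2 := hf.diag_exch (bar a) (bar w) (bar u)
      have h3 := hf.lip_both (bar r) (bar a) (bar r) (bar w)
      simp only [triVal, hc.dist_bar, hc.bar_dist, hc.bar_bar, dist_comm, hf.symm]
        at h0 h2 h3 hg ⊢
      linarith [hc.perimeter_le u v w, hc.perimeter_le r v w, hc.perimeter_le r u w]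
    · refine ⟨bar a, v, u, ?_⟩
      have h2 := hf.diag_exch (bar a) u (bar v)
      have h3 := hf.lip_both u (bar w) a a
      have h4 := hf.lip_both (bar r) (bar a) (bar r) u
      simp only [triVal, hc.dist_bar, hc.bar_dist, hc.bar_bar, dist_comm, dist_self, hf.symm]
        at h0 h2 h3 h4 hg ⊢
      linarith
  · refine ⟨bar v, a, u, ?_⟩
    have h1 := hf.diag_exch (bar a) u (bar v)
    have h2 := hf.lip_both (bar r) (bar a) (bar r) u
    have h3 := hf.lip_both u (bar w) v v
    simp only [triVal, hc.dist_bar, hc.bar_dist, hc.bar_bar, dist_comm, dist_self, hf.symm]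
      at h1 h2 h3 hg ⊢
    linarith
  · rcases hf.exch u (bar v) v (bar w) with h0 | h0
    · refine ⟨bar a, a, bar u, ?_⟩
      have h2 := hf.lip_both (bar r) (bar v) (bar r) (bar w)
      have h3 := hf.lip_both u u a v
      simp only [triVal, hc.dist_bar, hc.bar_dist, hc.bar_bar, dist_comm, dist_self, hf.symm]
        at h0 h2 h3 hg ⊢
      linarith
    · refine ⟨bar a, a, bar u, ?_⟩
      have h2 := hf.lip_both (bar r) (bar v) (bar r) v
      have h3 := hf.lip_both u u a (bar w)
      simp only [triVal, hc.dist_bar, hc.bar_dist, hc.bar_bar, dist_comm, dist_self, hf.symm]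
        at h0 h2 h3 hg ⊢
      linarith
  · rcases hf.exch u (bar v) v (bar w) with h0 | h0
    · refine ⟨bar a, a, bar u, ?_⟩
      have h2 := hf.lip_both (bar r) (bar v) (bar r) (bar w)
      have h3 := hf.lip_both u u a v
      simp only [triVal, hc.dist_bar, hc.bar_dist, hc.bar_bar, dist_comm, dist_self, hf.symm]
        at h0 h2 h3 hg ⊢
      linarith
    · refine ⟨bar a, v, a, ?_⟩
      have h2 := hf.diag_exch (bar a) (bar v) v
      have h3 := hf.lip_both (bar r) u (bar r) (bar w)
      have h4 := hf.lip_both a a a (bar u)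
      simp only [triVal, hc.dist_bar, hc.bar_dist, hc.bar_bar, dist_comm, dist_self, hf.symm]
        at h0 h2 h3 h4 hg ⊢
      linarith
  · rcases hf.exch u (bar v) v (bar w) with h0 | h0
    · refine ⟨bar v, a, u, ?_⟩
      have h2 := hf.diag_exch (bar a) (bar v) (bar w)
      have h3 := hf.lip_both (bar r) (bar a) (bar r) (bar w)
      simp only [triVal, hc.dist_bar, hc.bar_dist, hc.bar_bar, dist_comm, hf.symm]
        at h0 h2 h3 hg ⊢
      linarith
    · refine ⟨bar a, v, a, ?_⟩
      have h2 := hf.diag_exch (bar a) (bar v) v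
      have h3 := hf.lip_both (bar r) u (bar r) (bar w)
      have h4 := hf.lip_both a a a (bar u)
      simp only [triVal, hc.dist_bar, hc.bar_dist, hc.bar_bar, dist_comm, dist_self, hf.symm]
        at h0 h2 h3 h4 hg ⊢
      linarith
  · rcases hf.exch u (bar v) a (bar u) with h0 | h0
    · refine ⟨bar u, v, a, ?_⟩
      have h2 := hf.diag_exch (bar a) v (bar w)
      have h3 := hf.lip_both (bar r) (bar a) (bar r) (bar w)
      simp only [triVal, hc.dist_bar, hc.bar_dist, hc.bar_bar, dist_comm, hf.symm]
        at h0 h2 h3 hg ⊢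
      linarith [hc.perimeter_le u v w, hc.perimeter_le r v w, hc.perimeter_le r u w]
    · have h1 := hf.diag_exch (bar a) u (bar u)
      refine ⟨bar a, u, bar v, ?_⟩
      rcases hf.exch (bar a) u v (bar w) with h2 | h2
      · have h4 := hf.lip_both (bar r) (bar a) (bar r) v
        have h5 := hf.lip_both u u v (bar w)
        simp only [triVal, hc.dist_bar, hc.bar_dist, hc.bar_bar, dist_comm, dist_self, hf.symm]
          at h0 h1 h2 h4 h5 hg ⊢
        linarith
      · have h4 := hf.lip_both (bar r) (bar a) (bar r) (bar w)
        simp only [triVal, hc.dist_bar, hc.bar_dist, hc.bar_bar, dist_comm, hf.symm]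
          at h0 h1 h2 h4 hg ⊢
        linarith [hc.perimeter_le u v w, hc.perimeter_le r v w, hc.perimeter_le r u w]
  · rcases hf.exch u (bar v) a (bar u) with h0 | h0
    · refine ⟨bar u, v, a, ?_⟩
      have h2 := hf.diag_exch (bar a) v (bar w)
      have h3 := hf.lip_both (bar r) (bar a) (bar r) (bar w)
      simp only [triVal, hc.dist_bar, hc.bar_dist, hc.bar_bar, dist_comm, hf.symm]
        at h0 h2 h3 hg ⊢
      linarith [hc.perimeter_le u v w, hc.perimeter_le r v w, hc.perimeter_le r u w]
    · refine ⟨bar a, u, bar v, ?_⟩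
      have h2 := hf.diag_exch (bar a) u (bar u)
      have h3 := hf.lip_both (bar r) (bar a) (bar r) u
      have h4 := hf.lip_both u (bar w) v v
      simp only [triVal, hc.dist_bar, hc.bar_dist, hc.bar_bar, dist_comm, dist_self, hf.symm]
        at h0 h2 h3 h4 hg ⊢
      linarith

/-- The decisive inequality: whatever summands realise the three work function values of the
potential anchored at `a`, some triple has a potential anchored at `r` which is not larger. -/
lemma exists_triVal_le (hc : IsCircle D bar) (hf : IsPairFn f) (r a u v w : Ω) {W₁ W₂ W₃ : ℝ}
    (h₁ : f u (bar v) + dist a r ≤ W₁ ∨ f a (bar v) + dist u r ≤ W₁ ∨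
      f u a + dist (bar v) r ≤ W₁)
    (h₂ : f v (bar w) + dist a r ≤ W₂ ∨ f a (bar w) + dist v r ≤ W₂ ∨
      f v a + dist (bar w) r ≤ W₂)
    (h₃ : f w (bar u) + dist a r ≤ W₃ ∨ f a (bar u) + dist w r ≤ W₃ ∨
      f w a + dist (bar u) r ≤ W₃) :
    ∃ x y z, triVal f bar r x y z ≤ f (bar a) (bar a) - dist a r + W₁ + W₂ + W₃
      - (dist u v + dist v w + dist w u) := by
  have mono : ∀ {C C' : ℝ}, (∃ x y z, triVal f bar r x y z ≤ C) → C ≤ C' →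
      ∃ x y z, triVal f bar r x y z ≤ C' :=
    fun ⟨x, y, z, h⟩ h' => ⟨x, y, z, h.trans h'⟩
  rcases h₁ with h₁ | h₁ | h₁ <;> rcases h₂ with h₂ | h₂ | h₂ <;> rcases h₃ with h₃ | h₃ | h₃
  refine mono (exists_triVal_le_AAA hc hf r a u v w) ?_; rotate_left
  refine mono (exists_triVal_le_AAS hc hf r a u v w) ?_; rotate_left
  refine mono (exists_triVal_le_AAS hc hf r a (bar w) (bar v) (bar u)) ?_; rotate_left
  refine mono (exists_triVal_le_AAS hc hf r a w u v) ?_; rotate_left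
  refine mono (exists_triVal_le_ASS hc hf r a u v w) ?_; rotate_left
  refine mono (exists_triVal_le_AST hc hf r a u v w) ?_; rotate_left
  refine mono (exists_triVal_le_AAS hc hf r a (bar v) (bar u) (bar w)) ?_; rotate_left
  refine mono (exists_triVal_le_ATS hc hf r a u v w) ?_; rotate_left
  refine mono (exists_triVal_le_ASS hc hf r a (bar v) (bar u) (bar w)) ?_; rotate_left
  refine mono (exists_triVal_le_AAS hc hf r a v w u) ?_; rotate_left
  refine mono (exists_triVal_le_ASS hc hf r a v w u) ?_; rotate_left
  refine mono (exists_triVal_le_ATS hc hf r a v w u) ?_; rotate_left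
  refine mono (exists_triVal_le_ASS hc hf r a w u v) ?_; rotate_left
  refine mono (exists_triVal_le_SSS hc hf r a u v w) ?_; rotate_left
  refine mono (exists_triVal_le_SST hc hf r a u v w) ?_; rotate_left
  refine mono (exists_triVal_le_AST hc hf r a w u v) ?_; rotate_left
  refine mono (exists_triVal_le_SST hc hf r a w u v) ?_; rotate_left
  refine mono (exists_triVal_le_SST hc hf r a (bar u) (bar w) (bar v)) ?_; rotate_left
  refine mono (exists_triVal_le_AAS hc hf r a (bar u) (bar w) (bar v)) ?_; rotate_left
  refine mono (exists_triVal_le_AST hc hf r a v w u) ?_; rotate_left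
  refine mono (exists_triVal_le_ASS hc hf r a (bar w) (bar v) (bar u)) ?_; rotate_left
  refine mono (exists_triVal_le_ATS hc hf r a w u v) ?_; rotate_left
  refine mono (exists_triVal_le_SST hc hf r a v w u) ?_; rotate_left
  refine mono (exists_triVal_le_SST hc hf r a (bar v) (bar u) (bar w)) ?_; rotate_left
  refine mono (exists_triVal_le_ASS hc hf r a (bar u) (bar w) (bar v)) ?_; rotate_left
  refine mono (exists_triVal_le_SST hc hf r a (bar w) (bar v) (bar u)) ?_; rotate_left
  refine mono (exists_triVal_le_SSS hc hf r a (bar w) (bar v) (bar u)) ?_; rotate_left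
  all_goals
    simp only [hc.dist_bar, hc.bar_dist, hc.bar_bar, dist_comm, hf.symm] at h₁ h₂ h₃ ⊢
    linarith

end CircleGeometry

section AddCircle

variable {Δ : ℝ}

lemma AddCircle.exists_coe_eq_norm (hΔ : 0 < Δ) (x : AddCircle (2 * Δ)) :
    ∃ t : ℝ, (t : AddCircle (2 * Δ)) = x ∧ |t| ≤ Δ ∧ ‖x‖ = |t| := by
  have : Fact (0 < 2 * Δ) := ⟨by linarith⟩
  obtain ⟨t, ⟨ht, ht'⟩, rfl⟩ : ∃ t ∈ Set.Ioc (-Δ) (-Δ + 2 * Δ), (t : AddCircle (2 * Δ)) = x :=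
    ⟨AddCircle.equivIoc (2 * Δ) (-Δ) x, (AddCircle.equivIoc (2 * Δ) (-Δ) x).2,
      AddCircle.coe_equivIoc⟩
  have h : |t| ≤ Δ := abs_le.2 ⟨ht.le, by linarith⟩
  refine ⟨t, rfl, h, ?_⟩
  rw [AddCircle.norm_coe_eq_abs_iff _ (by linarith), abs_of_pos (by linarith : 0 < 2 * Δ)]
  linarith

lemma AddCircle.norm_coe_of_abs_le (hΔ : 0 < Δ) {t : ℝ} (ht : |t| ≤ Δ) :
    ‖(t : AddCircle (2 * Δ))‖ = |t| := by
  rw [AddCircle.norm_coe_eq_abs_iff _ (by linarith), abs_of_pos (by linarith : 0 < 2 * Δ)]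
  linarith

lemma AddCircle.coe_sub_two_mul (t : ℝ) :
    ((t - 2 * Δ : ℝ) : AddCircle (2 * Δ)) = t := by
  rw [AddCircle.coe_sub, AddCircle.coe_period, sub_zero]

lemma AddCircle.isCircle (hΔ : 0 < Δ) :
    IsCircle Δ (fun x : AddCircle (2 * Δ) => x + (Δ : ℝ)) where
  dist_bar x y := by
    obtain ⟨t, ht, h, hn⟩ := AddCircle.exists_coe_eq_norm hΔ (x - y)
    obtain ⟨h1, h2⟩ := abs_le.1 h
    rw [dist_eq_norm, dist_eq_norm, hn, show x + (Δ : AddCircle (2 * Δ)) - y = (t + Δ : ℝ) by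
      rw [AddCircle.coe_add, ht]; abel]
    rcases le_total t 0 with h0 | h0
    · rw [AddCircle.norm_coe_of_abs_le hΔ (abs_le.2 ⟨by linarith, by linarith⟩),
        abs_of_nonneg (by linarith), abs_of_nonpos h0]
      ring
    · rw [← AddCircle.coe_sub_two_mul,
        AddCircle.norm_coe_of_abs_le hΔ (abs_le.2 ⟨by linarith, by linarith⟩),
        abs_of_nonpos (by linarith), abs_of_nonneg h0]
      ring
  bar_bar x := by
    rw [add_assoc, ← AddCircle.coe_add, ← two_mul, AddCircle.coe_period, add_zero]
  side r := by
    choose ξ hξ hle hn using fun x : AddCircle (2 * Δ) =>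
      AddCircle.exists_coe_eq_norm hΔ (x - r)
    have opp : ∀ x y, 0 ≤ ξ x → ξ y < 0 → dist x y ≤ Δ ∧
        (dist x y = |ξ x| + |ξ y| ∨ dist x y = 2 * Δ - (|ξ x| + |ξ y|)) := by
      intro x y hx hy
      have h1 := abs_le.1 (hle x)
      have h2 := abs_le.1 (hle y)
      rw [dist_eq_norm, show x - y = ((ξ x - ξ y : ℝ) : AddCircle (2 * Δ)) by
        rw [AddCircle.coe_sub, hξ, hξ]; abel, abs_of_nonneg hx, abs_of_neg hy]
      rcases le_total (ξ x - ξ y) Δ with h | h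
      · rw [AddCircle.norm_coe_of_abs_le hΔ (abs_le.2 ⟨by linarith, by linarith⟩),
          abs_of_nonneg (by linarith)]
        exact ⟨h, Or.inl (by ring)⟩
      · rw [← AddCircle.coe_sub_two_mul,
          AddCircle.norm_coe_of_abs_le hΔ (abs_le.2 ⟨by linarith, by linarith⟩),
          abs_of_nonpos (by linarith)]
        exact ⟨by linarith, Or.inr (by ring)⟩
    have same : ∀ x y, (0 ≤ ξ x ↔ 0 ≤ ξ y) → 0 ≤ dist x y ∧
        (dist x y = |ξ x| - |ξ y| ∨ dist x y = |ξ y| - |ξ x|) := by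
      intro x y hxy
      refine ⟨dist_nonneg, ?_⟩
      have h1 := abs_le.1 (hle x)
      have h2 := abs_le.1 (hle y)
      have h : |ξ x - ξ y| = |ξ x| - |ξ y| ∨ |ξ x - ξ y| = |ξ y| - |ξ x| := by grind
      have h' : |ξ x - ξ y| ≤ Δ := by grind
      rwa [dist_eq_norm, show x - y = ((ξ x - ξ y : ℝ) : AddCircle (2 * Δ)) by
        rw [AddCircle.coe_sub, hξ, hξ]; abel, AddCircle.norm_coe_of_abs_le hΔ h']
    refine ⟨fun x => decide (0 ≤ ξ x), fun x y => ?_⟩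
    rw [dist_eq_norm x r, dist_eq_norm y r, hn, hn]
    unfold PairDist
    by_cases hx : 0 ≤ ξ x <;> by_cases hy : 0 ≤ ξ y <;>
      simp only [hx, hy, decide_true, decide_false]
    · simpa using same x y (by simp [hx, hy])
    · simpa using opp x y hx (not_le.1 hy)
    · have h := opp y x hy (not_le.1 hx)
      rw [dist_comm y x, add_comm] at h
      simpa using h
    · simpa using same x y (by simp [hx, hy])

end AddCircle

/-- The least cost of reaching `{x, y, z}` when one server sits at `ρ` and the remaining two
servers are described by the function `f`. -/
noncomputable def serve {Ω : Type*} [MetricSpace Ω] (f : Ω → Ω → ℝ) (ρ x y z : Ω) : ℝ :=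
  min (f y z + dist x ρ) (min (f x z + dist y ρ) (f x y + dist z ρ))

section Serve

variable {Ω : Type*} [MetricSpace Ω] {f : Ω → Ω → ℝ}

lemma serve_le_fst (f : Ω → Ω → ℝ) (ρ x y z : Ω) : serve f ρ x y z ≤ f y z + dist x ρ :=
  min_le_left _ _

lemma serve_le_snd (f : Ω → Ω → ℝ) (ρ x y z : Ω) : serve f ρ x y z ≤ f x z + dist y ρ :=
  (min_le_right _ _).trans (min_le_left _ _)

lemma serve_le_thd (f : Ω → Ω → ℝ) (ρ x y z : Ω) : serve f ρ x y z ≤ f x y + dist z ρ :=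
  (min_le_right _ _).trans (min_le_right _ _)

lemma serve_cases (f : Ω → Ω → ℝ) (ρ x y z : Ω) :
    serve f ρ x y z = f y z + dist x ρ ∨ serve f ρ x y z = f x z + dist y ρ ∨
      serve f ρ x y z = f x y + dist z ρ := by
  unfold serve
  rcases min_choice (f y z + dist x ρ) (min (f x z + dist y ρ) (f x y + dist z ρ)) with h | h
  · exact Or.inl h
  · rw [h]
    exact Or.inr (min_choice _ _)

lemma IsPairFn.serve_swap_left (hf : IsPairFn f) (ρ x y z : Ω) :
    serve f ρ x y z = serve f ρ y x z := by
  unfold serve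
  rw [min_left_comm, hf.symm x y]

lemma IsPairFn.serve_swap_right (hf : IsPairFn f) (ρ x y z : Ω) :
    serve f ρ x y z = serve f ρ x z y := by
  unfold serve
  rw [hf.symm y z, min_comm (f x z + dist y ρ)]

lemma IsPairFn.serve_lip (hf : IsPairFn f) (ρ x x' y z : Ω) :
    serve f ρ x y z ≤ serve f ρ x' y z + dist x x' := by
  rcases serve_cases f ρ x' y z with h | h | h <;> rw [h]
  · linarith [serve_le_fst f ρ x y z, dist_triangle x x' ρ]
  · linarith [serve_le_snd f ρ x y z, hf.lip x x' z]
  · linarith [serve_le_thd f ρ x y z, hf.lip x x' y]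

lemma IsPairFn.serve_lip_all (hf : IsPairFn f) (ρ x x' y y' z z' : Ω) :
    serve f ρ x y z ≤ serve f ρ x' y' z' + (dist x x' + dist y y' + dist z z') := by
  have h1 := hf.serve_lip ρ x x' y z
  have h2 := hf.serve_lip ρ y y' x' z
  have h3 := hf.serve_lip ρ z z' y' x'
  rw [hf.serve_swap_left ρ y, hf.serve_swap_left ρ y'] at h2
  rw [hf.serve_swap_left ρ z, hf.serve_swap_right, hf.serve_swap_left ρ y',
    hf.serve_swap_left ρ z', hf.serve_swap_right ρ y' z', hf.serve_swap_left ρ y'] at h3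
  linarith

lemma IsPairFn.serve_request (hf : IsPairFn f) (ρ r : Ω) : IsPairFn (serve f ρ r) where
  symm x y := hf.serve_swap_right ρ r x y
  lip x x' y := by
    rw [hf.serve_swap_left ρ r x, hf.serve_swap_left ρ r x']
    exact hf.serve_lip ρ x x' r y
  exch p q s t := by
    have U := serve_le_fst f ρ r
    have V := serve_le_snd f ρ r
    have W := serve_le_thd f ρ r
    rcases serve_cases f ρ r p q with h | h | h <;>
    rcases serve_cases f ρ r s t with h' | h' | h' <;> rw [h, h']
    · rcases hf.exch p q s t with e | e
      · left; linarith [U p s, U q t]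
      · right; linarith [U p t, U q s]
    · rcases hf.exch p q r t with e | e
      · left; linarith [W p s, U q t, hf.symm p r]
      · right; linarith [U p t, W q s, hf.symm q r]
    · rcases hf.exch p q r s with e | e
      · right; linarith [W p t, U q s, hf.symm p r]
      · left; linarith [U p s, W q t, hf.symm q r]
    · rcases hf.exch s t r q with e | e
      · left; linarith [V p s, U q t, hf.symm s r, hf.symm t q]
      · right; linarith [V p t, U q s, hf.symm t r, hf.symm s q]
    · right; linarith [V p t, W q s]
    · left; linarith [V p s, W q t]
    · rcases hf.exch s t r p with e | e
      · right; linarith [U p t, V q s, hf.symm s r, hf.symm t p]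
      · left; linarith [U p s, V q t, hf.symm t r, hf.symm s p]
    · left; linarith [W p s, V q t]
    · right; linarith [W p t, V q s]

/-- Exchange property between the configuration `{s, b, b}` and an arbitrary configuration. -/
lemma IsPairFn.serve_exch (hf : IsPairFn f) (ρ s b x y z : Ω) :
    serve f ρ x b b + serve f ρ s y z ≤ serve f ρ s b b + serve f ρ x y z ∨
    serve f ρ y b b + serve f ρ s x z ≤ serve f ρ s b b + serve f ρ x y z ∨
    serve f ρ z b b + serve f ρ s x y ≤ serve f ρ s b b + serve f ρ x y z := by
  have U := serve_le_fst f ρ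
  have V := serve_le_snd f ρ
  have W := serve_le_thd f ρ
  have hb : serve f ρ s b b = f b b + dist s ρ ∨ serve f ρ s b b = f s b + dist b ρ := by
    rcases serve_cases f ρ s b b with h | h | h <;> simp [h]
  rcases hb with h | h <;> rcases serve_cases f ρ x y z with h' | h' | h' <;> rw [h, h']
  · left; linarith [U x b b, U s y z]
  · right; left; linarith [U y b b, U s x z]
  · right; right; linarith [U z b b, U s x y]
  · rcases hf.exch s b y z with e | e
    · right; right; linarith [W s x y, V s x y, W z b b, hf.symm z b]
    · right; left; linarith [V s x z, W y b b, hf.symm y b]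
  · rcases hf.exch s b x z with e | e
    · right; right; linarith [W s x y, W z b b, hf.symm z b]
    · left; linarith [V s y z, W x b b, hf.symm x b]
  · rcases hf.exch s b x y with e | e
    · right; left; linarith [W s x z, W y b b, hf.symm y b]
    · left; linarith [W s y z, W x b b, hf.symm x b]

lemma serve_nonneg (hf : ∀ x y, 0 ≤ f x y) (ρ x y z : Ω) : 0 ≤ serve f ρ x y z := by
  have h : ∀ p q s t : Ω, 0 ≤ f p q + dist s t := fun p q s t => add_nonneg (hf p q) dist_nonneg
  exact le_min (h _ _ _ _) (le_min (h _ _ _ _) (h _ _ _ _))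

variable {D : ℝ} {bar : Ω → Ω}

/-- Among all configurations, the tripled antipode of the request has the largest increase. -/
lemma IsPairFn.serve_increase_le (hc : IsCircle D bar) (hf : IsPairFn f) (ρ r x y z : Ω) :
    serve (serve f ρ r) r x y z - serve f ρ x y z ≤
      serve (serve f ρ r) r (bar r) (bar r) (bar r) - serve f ρ (bar r) (bar r) (bar r) := by
  have h : serve f ρ r (bar r) (bar r) + D ≤ serve (serve f ρ r) r (bar r) (bar r) (bar r) := by
    rcases serve_cases (serve f ρ r) r (bar r) (bar r) (bar r) with h | h | h <;>
      rw [h, hc.dist_bar, dist_self] <;> linarith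
  have hl : ∀ p, serve f ρ (bar r) (bar r) (bar r) ≤
      serve f ρ p (bar r) (bar r) + (D - dist p r) := fun p => by
    have := hf.serve_lip ρ (bar r) p (bar r) (bar r)
    rwa [hc.dist_bar, dist_comm] at this
  rcases hf.serve_exch ρ r (bar r) x y z with e | e | e
  · linarith [hl x, serve_le_fst (serve f ρ r) r x y z]
  · linarith [hl y, serve_le_snd (serve f ρ r) r x y z]
  · linarith [hl z, serve_le_thd (serve f ρ r) r x y z]

/-- The potential of a work function `W` at the anchor `a` and the cyclic triple `(u, v, w)`. -/
def potential (bar : Ω → Ω) (W : Ω → Ω → Ω → ℝ) (a u v w : Ω) : ℝ :=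
  W (bar a) (bar a) (bar a) + W a u (bar v) + W a v (bar w) + W a w (bar u)
    - (dist u v + dist v w + dist w u)

lemma IsPairFn.exists_potential_add_le (hc : IsCircle D bar) (hf : IsPairFn f)
    (ρ r a u v w : Ω) :
    ∃ x y z, potential bar (serve f ρ) r x y z +
      (serve (serve f ρ r) r (bar r) (bar r) (bar r) - serve f ρ (bar r) (bar r) (bar r)) ≤
        potential bar (serve (serve f ρ r) r) a u v w := by
  have h : ∀ u v, serve f ρ r u (bar v) + dist a r ≤ serve (serve f ρ r) r a u (bar v) ∨
      serve f ρ r a (bar v) + dist u r ≤ serve (serve f ρ r) r a u (bar v) ∨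
      serve f ρ r u a + dist (bar v) r ≤ serve (serve f ρ r) r a u (bar v) := fun u v => by
    rcases serve_cases (serve f ρ r) r a u (bar v) with h | h | h
    · exact Or.inl h.ge
    · exact Or.inr (Or.inl h.ge)
    · rw [(hf.serve_request ρ r).symm a u] at h
      exact Or.inr (Or.inr h.ge)
  have ha : serve f ρ r (bar a) (bar a) + (D - dist a r) ≤
      serve (serve f ρ r) r (bar a) (bar a) (bar a) := by
    rcases serve_cases (serve f ρ r) r (bar a) (bar a) (bar a) with h | h | h <;>
      rw [h, hc.dist_bar]
  have hr := serve_le_fst (serve f ρ r) r (bar r) (bar r) (bar r)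
  rw [hc.dist_bar, dist_self] at hr
  obtain ⟨x, y, z, hx⟩ :=
    exists_triVal_le hc (hf.serve_request ρ r) r a u v w (h u v) (h v w) (h w u)
  refine ⟨x, y, z, ?_⟩
  unfold potential
  unfold triVal at hx
  linarith

end Serve

section WorkFunction

variable {Ω : Type*} [MetricSpace Ω] {D : ℝ} {bar : Ω → Ω}

lemma confDist_le {k : ℕ} (X Y : Fin k → Ω) (σ : Equiv.Perm (Fin k)) :
    confDist X Y ≤ ∑ i, dist (X i) (Y (σ i)) :=
  ciInf_le (Set.finite_range _).bddBelow σ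

lemma confDist_le_of_bijective (X Y : Fin 3 → Ω) (g : Fin 3 → Fin 3)
    (hg : Function.Bijective g) :
    confDist X Y ≤ dist (X 0) (Y (g 0)) + dist (X 1) (Y (g 1)) + dist (X 2) (Y (g 2)) := by
  have h := confDist_le X Y (Equiv.ofBijective g hg)
  rwa [Fin.sum_univ_three] at h

/-- The request sequence, preceded by the position of the first server. -/
def request (X₀ : Fin 3 → Ω) (r : ℕ → Ω) : ℕ → Ω
  | 0 => X₀ 0
  | t + 1 => r (t + 1)

/-- The work function with one server pinned at the last request, as a function of the positions
of the other two servers. -/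
noncomputable def pairWork (X₀ : Fin 3 → Ω) (r : ℕ → Ω) : ℕ → Ω → Ω → ℝ
  | 0 => fun p q =>
      min (dist (X₀ 1) p + dist (X₀ 2) q) (dist (X₀ 1) q + dist (X₀ 2) p)
  | t + 1 => serve (pairWork X₀ r t) (request X₀ r t) (r (t + 1))

/-- Closed form of the work function for three servers. -/
noncomputable def tripleWork (X₀ : Fin 3 → Ω) (r : ℕ → Ω) (t : ℕ) : Ω → Ω → Ω → ℝ :=
  serve (pairWork X₀ r t) (request X₀ r t)

lemma isPairFn_min_matching (a b : Ω) :
    IsPairFn (fun p q => min (dist a p + dist b q) (dist a q + dist b p)) where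
  symm p q := min_comm _ _
  lip p p' q := by
    rw [← min_add_add_right]
    have h1 := dist_triangle_right a p p'
    have h2 := dist_triangle_right b p p'
    have h3 := dist_triangle a p' p
    have h4 := dist_triangle b p' p
    rw [dist_comm p' p] at h3 h4
    exact min_le_min (by linarith) (by linarith)
  exch p q s t := by
    have U : ∀ p q : Ω, min (dist a p + dist b q) (dist a q + dist b p) ≤ dist a p + dist b q :=
      fun _ _ => min_le_left _ _
    have V : ∀ p q : Ω, min (dist a p + dist b q) (dist a q + dist b p) ≤ dist a q + dist b p :=
      fun _ _ => min_le_right _ _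
    rcases min_choice (dist a p + dist b q) (dist a q + dist b p) with h | h <;>
    rcases min_choice (dist a s + dist b t) (dist a t + dist b s) with h' | h' <;> rw [h, h']
    · right; linarith [U p t, V q s]
    · left; linarith [U p s, V q t]
    · left; linarith [V p s, U q t]
    · right; linarith [V p t, U q s]

lemma isPairFn_pairWork (X₀ : Fin 3 → Ω) (r : ℕ → Ω) (t : ℕ) : IsPairFn (pairWork X₀ r t) := by
  induction t with
  | zero => exact isPairFn_min_matching _ _
  | succ t ih => exact ih.serve_request _ _

lemma pairWork_nonneg (X₀ : Fin 3 → Ω) (r : ℕ → Ω) (t : ℕ) (p q : Ω) :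
    0 ≤ pairWork X₀ r t p q := by
  induction t generalizing p q with
  | zero => exact le_min (add_nonneg dist_nonneg dist_nonneg) (add_nonneg dist_nonneg dist_nonneg)
  | succ t ih => exact serve_nonneg ih _ _ _ _

lemma IsPairFn.serve_comp_perm {f : Ω → Ω → ℝ} (hf : IsPairFn f) (ρ : Ω) (Y : Fin 3 → Ω)
    (σ : Equiv.Perm (Fin 3)) :
    serve f ρ (Y (σ 0)) (Y (σ 1)) (Y (σ 2)) = serve f ρ (Y 0) (Y 1) (Y 2) := by
  have h01 : σ 0 ≠ σ 1 := σ.injective.ne (by decide)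
  have h02 : σ 0 ≠ σ 2 := σ.injective.ne (by decide)
  have h12 : σ 1 ≠ σ 2 := σ.injective.ne (by decide)
  generalize σ 0 = i, σ 1 = j, σ 2 = k at *
  have hl := hf.serve_swap_left ρ
  have hr := hf.serve_swap_right ρ
  fin_cases i <;> fin_cases j <;> fin_cases k <;> simp at h01 h02 h12 <;> dsimp only
  · rfl
  · exact hr _ _ _
  · exact hl _ _ _
  · exact (hr _ _ _).trans (hl _ _ _)
  · exact (hl _ _ _).trans (hr _ _ _)
  · exact (hl _ _ _).trans ((hr _ _ _).trans (hl _ _ _))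

lemma tripleWork_le_add_confDist (X₀ : Fin 3 → Ω) (r : ℕ → Ω) (t : ℕ) (X Y : Fin 3 → Ω) :
    tripleWork X₀ r t (Y 0) (Y 1) (Y 2) ≤
      tripleWork X₀ r t (X 0) (X 1) (X 2) + confDist X Y := by
  have hf := isPairFn_pairWork X₀ r t
  rw [← sub_le_iff_le_add']
  refine le_ciInf fun σ => ?_
  rw [Fin.sum_univ_three, sub_le_iff_le_add', tripleWork,
    ← hf.serve_comp_perm (request X₀ r t) Y σ]
  have h := hf.serve_lip_all (request X₀ r t) (Y (σ 0)) (X 0) (Y (σ 1)) (X 1) (Y (σ 2)) (X 2)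
  rwa [dist_comm (Y (σ 0)), dist_comm (Y (σ 1)), dist_comm (Y (σ 2))] at h

lemma tripleWork_succ_le_of_mem (X₀ : Fin 3 → Ω) (r : ℕ → Ω) (t : ℕ) (X : Fin 3 → Ω)
    (hX : ∃ j, X j = r (t + 1)) :
    tripleWork X₀ r (t + 1) (X 0) (X 1) (X 2) ≤ tripleWork X₀ r t (X 0) (X 1) (X 2) := by
  have hf := isPairFn_pairWork X₀ r t
  have hl := hf.serve_swap_left (request X₀ r t)
  have hr := hf.serve_swap_right (request X₀ r t)
  have U := serve_le_fst (pairWork X₀ r (t + 1)) (r (t + 1)) (X 0) (X 1) (X 2)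
  have V := serve_le_snd (pairWork X₀ r (t + 1)) (r (t + 1)) (X 0) (X 1) (X 2)
  have W := serve_le_thd (pairWork X₀ r (t + 1)) (r (t + 1)) (X 0) (X 1) (X 2)
  obtain ⟨j, hj⟩ := hX
  fin_cases j <;> simp only [Fin.zero_eta, Fin.mk_one, Fin.reduceFinMk] at hj <;>
    simp only [pairWork, tripleWork, request, ← hj, dist_self, add_zero] at *
  · exact U
  · exact V.trans_eq (hl _ _ _)
  · exact W.trans_eq ((hl _ _ _).trans ((hr _ _ _)))

/-- Every schedule costs at least the closed form of the work function. -/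
lemma tripleWork_le_cost (X₀ : Fin 3 → Ω) (r : ℕ → Ω) (Y : ℕ → Fin 3 → Ω) (h0 : Y 0 = X₀)
    (t : ℕ) (hY : ∀ i ∈ Finset.Icc 1 t, ∃ j, Y i j = r i) :
    tripleWork X₀ r t (Y t 0) (Y t 1) (Y t 2) ≤
      ∑ i ∈ Finset.Icc 1 t, confDist (Y (i - 1)) (Y i) := by
  induction t with
  | zero =>
    have h := serve_le_fst (pairWork X₀ r 0) (X₀ 0) (X₀ 0) (X₀ 1) (X₀ 2)
    have h' : pairWork X₀ r 0 (X₀ 1) (X₀ 2) ≤ 0 := (min_le_left _ _).trans (by simp)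
    simp only [h0, tripleWork, request, Finset.Icc_eq_empty_of_lt Nat.zero_lt_one,
      Finset.sum_empty]
    rw [dist_self] at h
    linarith
  | succ t ih =>
    rw [Finset.sum_Icc_succ_top (by omega), Nat.add_sub_cancel]
    have h1 := ih fun i hi => hY i (Finset.Icc_subset_Icc_right (by omega) hi)
    have h2 := tripleWork_le_add_confDist X₀ r t (Y t) (Y (t + 1))
    have h3 := tripleWork_succ_le_of_mem X₀ r t (Y (t + 1)) (hY _ (by simp))
    linarith

/-- The closed form of the work function is attained by some schedule. -/
lemma exists_cost_le_tripleWork (X₀ : Fin 3 → Ω) (r : ℕ → Ω) (t : ℕ) (X : Fin 3 → Ω) :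
    ∃ Y : ℕ → Fin 3 → Ω, Y 0 = X₀ ∧ (∀ i ∈ Finset.Icc 1 t, ∃ j, Y i j = r i) ∧
      (∑ i ∈ Finset.Icc 1 t, confDist (Y (i - 1)) (Y i)) + confDist (Y t) X ≤
        tripleWork X₀ r t (X 0) (X 1) (X 2) := by
  induction t generalizing X with
  | zero =>
    refine ⟨fun _ => X₀, rfl, by simp, ?_⟩
    have H := confDist_le_of_bijective X₀ X
    simp only [tripleWork, serve, pairWork, request, ← min_add_add_right, le_min_iff,
      Finset.Icc_eq_empty_of_lt Nat.zero_lt_one, Finset.sum_empty, zero_add]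
    refine ⟨⟨?_, ?_⟩, ⟨?_, ?_⟩, ⟨?_, ?_⟩⟩
    · exact (H ![0, 1, 2] (by decide)).trans_eq (by simp [dist_comm]; ring)
    · exact (H ![0, 2, 1] (by decide)).trans_eq (by simp [dist_comm]; ring)
    · exact (H ![1, 0, 2] (by decide)).trans_eq (by simp [dist_comm]; ring)
    · exact (H ![1, 2, 0] (by decide)).trans_eq (by simp [dist_comm]; ring)
    · exact (H ![2, 0, 1] (by decide)).trans_eq (by simp [dist_comm]; ring)
    · exact (H ![2, 1, 0] (by decide)).trans_eq (by simp [dist_comm]; ring)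
  | succ t ih =>
    obtain ⟨j, hj⟩ : ∃ j, tripleWork X₀ r t (Function.update X j (r (t + 1)) 0)
        (Function.update X j (r (t + 1)) 1) (Function.update X j (r (t + 1)) 2) +
          dist (X j) (r (t + 1)) ≤ tripleWork X₀ r (t + 1) (X 0) (X 1) (X 2) := by
      have hf := isPairFn_pairWork X₀ r t
      have hl := hf.serve_swap_left (request X₀ r t)
      have hr := hf.serve_swap_right (request X₀ r t)
      rcases serve_cases (pairWork X₀ r (t + 1)) (r (t + 1)) (X 0) (X 1) (X 2) with h | h | h
      · refine ⟨0, le_of_eq ?_⟩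
        simpa [tripleWork, request, pairWork] using h.symm
      · refine ⟨1, le_of_eq ?_⟩
        rw [pairWork, hl] at h
        simpa [tripleWork, request, pairWork] using h.symm
      · refine ⟨2, le_of_eq ?_⟩
        rw [pairWork, hl, hr] at h
        simpa [tripleWork, request, pairWork] using h.symm
    set X' := Function.update X j (r (t + 1)) with hX'
    obtain ⟨Y, h0, hY, hc⟩ := ih X'
    refine ⟨Function.update Y (t + 1) X', by simp [h0], fun i hi => ?_, ?_⟩
    · rcases eq_or_ne i (t + 1) with rfl | hi'
      · exact ⟨j, by simp [hX']⟩
      · rw [Function.update_of_ne hi']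
        exact hY i (by simp at hi ⊢; omega)
    · rw [Finset.sum_Icc_succ_top (by omega), Nat.add_sub_cancel, Function.update_self,
        Function.update_of_ne (by omega : t ≠ t + 1)]
      have hs : ∑ i ∈ Finset.Icc 1 t, confDist (Function.update Y (t + 1) X' (i - 1))
          (Function.update Y (t + 1) X' i) = ∑ i ∈ Finset.Icc 1 t, confDist (Y (i - 1)) (Y i) := by
        refine Finset.sum_congr rfl fun i hi => ?_
        rw [Finset.mem_Icc] at hi
        rw [Function.update_of_ne (by omega), Function.update_of_ne (by omega)]
      have hd : confDist X' X ≤ dist (X j) (r (t + 1)) := by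
        refine (confDist_le X' X 1).trans_eq ?_
        rw [Finset.sum_eq_single j (fun i _ hij => by simp [hX', hij]) (by simp)]
        simp [hX', dist_comm]
      linarith

lemma workFn_eq_tripleWork (X₀ : Fin 3 → Ω) (r : ℕ → Ω) (t : ℕ) (X : Fin 3 → Ω) :
    workFn 3 X₀ r t X = tripleWork X₀ r t (X 0) (X 1) (X 2) := by
  have lower : ∀ c ∈ { c : ℝ | ∃ Y : ℕ → Fin 3 → Ω, Y 0 = X₀ ∧
      (∀ i ∈ Finset.Icc 1 t, ∃ j, Y i j = r i) ∧
      c = (∑ i ∈ Finset.Icc 1 t, confDist (Y (i - 1)) (Y i)) + confDist (Y t) X },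
      tripleWork X₀ r t (X 0) (X 1) (X 2) ≤ c := by
    rintro c ⟨Y, h0, hY, rfl⟩
    linarith [tripleWork_le_cost X₀ r Y h0 t hY, tripleWork_le_add_confDist X₀ r t (Y t) X]
  obtain ⟨Y, h0, hY, h⟩ := exists_cost_le_tripleWork X₀ r t X
  exact le_antisymm ((csInf_le ⟨_, lower⟩ ⟨Y, h0, hY, rfl⟩).trans h)
    (le_csInf ⟨_, Y, h0, hY, rfl⟩ lower)

/-- The potential dominates the accumulated extended cost. -/
lemma sum_increase_le_potential (hc : IsCircle D bar) (X₀ : Fin 3 → Ω) (r : ℕ → Ω) (T : ℕ)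
    (a u v w : Ω) :
    ∑ t ∈ Finset.Icc 1 T, (tripleWork X₀ r t (bar (r t)) (bar (r t)) (bar (r t)) -
      tripleWork X₀ r (t - 1) (bar (r t)) (bar (r t)) (bar (r t))) - 3 * D ≤
        potential bar (tripleWork X₀ r T) a u v w := by
  induction T generalizing a u v w with
  | zero =>
    have h : ∀ x y z, 0 ≤ tripleWork X₀ r 0 x y z :=
      serve_nonneg (pairWork_nonneg X₀ r 0) _
    rw [Finset.Icc_eq_empty_of_lt Nat.zero_lt_one, Finset.sum_empty, potential]
    linarith [h (bar a) (bar a) (bar a), h a u (bar v), h a v (bar w), h a w (bar u),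
      hc.dist_le u v, hc.dist_le v w, hc.dist_le w u]
  | succ T ih =>
    rw [Finset.sum_Icc_succ_top (by omega), Nat.add_sub_cancel]
    obtain ⟨x, y, z, h⟩ := (isPairFn_pairWork X₀ r T).exists_potential_add_le hc
      (request X₀ r T) (r (T + 1)) a u v w
    have h' := ih (r (T + 1)) x y z
    change potential bar (tripleWork X₀ r T) (r (T + 1)) x y z +
      (tripleWork X₀ r (T + 1) _ _ _ - tripleWork X₀ r T _ _ _) ≤
        potential bar (tripleWork X₀ r (T + 1)) a u v w at h
    linarith

lemma iSup_workFn_sub_le (hc : IsCircle D bar) (X₀ : Fin 3 → Ω) (r : ℕ → Ω) (t : ℕ)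
    (ht : 1 ≤ t) :
    ⨆ X : Fin 3 → Ω, (workFn 3 X₀ r t X - workFn 3 X₀ r (t - 1) X) ≤
      tripleWork X₀ r t (bar (r t)) (bar (r t)) (bar (r t)) -
        tripleWork X₀ r (t - 1) (bar (r t)) (bar (r t)) (bar (r t)) := by
  have : Nonempty (Fin 3 → Ω) := ⟨X₀⟩
  refine ciSup_le fun X => ?_
  rw [workFn_eq_tripleWork, workFn_eq_tripleWork]
  obtain ⟨t, rfl⟩ := Nat.exists_eq_add_of_le' ht
  exact (isPairFn_pairWork X₀ r t).serve_increase_le hc _ _ _ _ _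

lemma potential_le_cost (hc : IsCircle D bar) (X₀ : Fin 3 → Ω) (r : ℕ → Ω) (T : ℕ)
    (Y : ℕ → Fin 3 → Ω) (h0 : Y 0 = X₀) (hY : ∀ i ∈ Finset.Icc 1 T, ∃ j, Y i j = r i)
    (a u v w : Ω) :
    potential bar (tripleWork X₀ r T) a u v w ≤
      4 * ∑ i ∈ Finset.Icc 1 T, confDist (Y (i - 1)) (Y i) + 12 * D := by
  have h : ∀ x y z, tripleWork X₀ r T x y z ≤
      ∑ i ∈ Finset.Icc 1 T, confDist (Y (i - 1)) (Y i) + 3 * D := fun x y z => by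
    have h1 := tripleWork_le_cost X₀ r Y h0 T hY
    have h2 := (isPairFn_pairWork X₀ r T).serve_lip_all (request X₀ r T) x (Y T 0) y (Y T 1)
      z (Y T 2)
    change tripleWork X₀ r T x y z ≤ tripleWork X₀ r T _ _ _ + _ at h2
    linarith [hc.dist_le x (Y T 0), hc.dist_le y (Y T 1), hc.dist_le z (Y T 2)]
  rw [potential]
  linarith [h (bar a) (bar a) (bar a), h a u (bar v), h a v (bar w), h a w (bar u),
    dist_nonneg (x := u) (y := v), dist_nonneg (x := v) (y := w), dist_nonneg (x := w) (y := u)]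

end WorkFunction

/-- For every `3`-server instance on the circle of circumference `2Δ`, the total
extended cost is at most `4 · OPT + c` for a constant `c` independent of `T`. -/
theorem extended_cost_bound_on_circle (Δ : ℝ) (hΔ : 0 < Δ)
    (X₀ : Fin 3 → AddCircle (2*Δ)) :
    ∃ c : ℝ, ∀ (T : ℕ) (r : ℕ → AddCircle (2*Δ)),
      ∑ t ∈ Finset.Icc 1 T,
          (⨆ X : Fin 3 → AddCircle (2*Δ),
            (workFn 3 X₀ r t X - workFn 3 X₀ r (t - 1) X)) ≤
        4 * opt 3 X₀ r T + c := by
  have hc := AddCircle.isCircle hΔ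
  refine ⟨15 * Δ, fun T r => ?_⟩
  set x₀ := X₀ 0
  have hsum := sum_increase_le_potential hc X₀ r T x₀ x₀ x₀ x₀
  have hext := Finset.sum_le_sum fun t (ht : t ∈ Finset.Icc 1 T) =>
    iSup_workFn_sub_le hc X₀ r t (Finset.mem_Icc.1 ht).1
  have hopt : (potential (fun x => x + (Δ : AddCircle (2 * Δ))) (tripleWork X₀ r T) x₀ x₀ x₀ x₀ -
      12 * Δ) / 4 ≤ opt 3 X₀ r T := by
    obtain ⟨Y, h0, hY, -⟩ := exists_cost_le_tripleWork X₀ r T X₀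
    refine le_csInf ⟨_, Y, h0, hY, rfl⟩ ?_
    rintro c ⟨Y, h0, hY, rfl⟩
    linarith [potential_le_cost hc X₀ r T Y h0 hY x₀ x₀ x₀ x₀]
  linarith
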